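/- Let Σ₀ be a closed strictly convex smooth initial hypersurface enclosing a shrinking obstacle Φ, and let {Σ_t}_{0≤t<T} be a solution of the penalized problem (∗_δ). Then the Gauss curvature of Σ_t satisfies max_{𝕊^n×[0,T)} K ≤ C, where C = C(n,α,Σ₀,Φ) is independent of δ and T. -/

import Mathlib

/-!
STATEMENT 9: Let `Σ₀` be a closed strictly convex smooth initial hypersurface enclosing a
shrinking obstacle `Φ`, and let `{Σ_t}_{0≤t<T}` be a solution of the penalized problem
`(∗_δ)`.  Then the Gauss curvature of `Σ_t` satisfies `max_{𝕊ⁿ×[0,T)} K ≤ C`, where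
`C = C(n,α,Σ₀,Φ)` is independent of `δ` and `T` (the constant is chosen before `δ` and `T`).
-/

open scoped BigOperators RealInnerProductSpace
noncomputable section

abbrev ES (n : ℕ) := EuclideanSpace ℝ (Fin (n + 1))

/-- The unit sphere `𝕊^n ⊂ ℝ^{n+1}`. -/
def Sph (n : ℕ) : Set (ES n) := Metric.sphere 0 1

/-- Second derivative of `f` at `z` in the directions `v, w`. -/
def hbil {F : Type*} [NormedAddCommGroup F] [NormedSpace ℝ F] (f : F → ℝ) (z v w : F) : ℝ :=
  fderiv ℝ (fun x => fderiv ℝ f x w) z v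

/-- For the 1-homogeneous extension `U` of the support function of a convex body and a unit
vector `z`, `suppHessDet n U z = det(D²U(z) + z⊗z)` equals
`det(∇̄_i∇̄_j u + u ḡ_{ij})/det(ḡ_{ij})`, the product of the principal radii of curvature;
the Gauss curvature at the point with outer normal `z` is its inverse,
`K = det ḡ/det(∇̄²u + uḡ) = (suppHessDet n U z)⁻¹`. -/
def suppHessDet (n : ℕ) (U : ES n → ℝ) (z : ES n) : ℝ :=
  (Matrix.of fun i j : Fin (n + 1) =>
      hbil U z (EuclideanSpace.single i 1) (EuclideanSpace.single j 1) +
        ⟪z, EuclideanSpace.single i 1⟫ * ⟪z, EuclideanSpace.single j 1⟫).det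

/-- `u₀` is the (1-homogeneously extended) support function of a closed strictly convex
smooth hypersurface. -/
def IsSupportOfSmoothBody (n : ℕ) (u₀ : ES n → ℝ) : Prop :=
  (∀ c : ℝ, 0 < c → ∀ x, u₀ (c • x) = c * u₀ x) ∧
    ContDiffOn ℝ (⊤ : ℕ∞) u₀ {(0 : ES n)}ᶜ ∧
    ∀ z ∈ Sph n, ∀ v : ES n, ⟪v, z⟫ = 0 → v ≠ 0 → 0 < hbil u₀ z v v

/-- A shrinking obstacle `Φ_t = ∂Ω(t)`: a decreasing family of strictly convex bodies
(whose limit contains the origin as interior point), with support functions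
`φ ∈ C^{3,1}(𝕊ⁿ×[0,∞))` (extended 1-homogeneously), `∂_tφ < 0`, `−∂_tφ` non-increasing,
and principal curvatures `μ_i` positive, non-decreasing in `t` and bounded. -/
structure ShrinkingObstacle (n : ℕ) : Type where
  φ : ES n → ℝ → ℝ
  homog : ∀ t : ℝ, 0 ≤ t → ∀ c : ℝ, 0 < c → ∀ x, φ (c • x) t = c * φ x t
  smooth : ContDiffOn ℝ 3 (fun p : ES n × ℝ => φ p.1 p.2) ({(0 : ES n)}ᶜ ×ˢ Set.Ici 0)
  φt : ES n → ℝ → ℝ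
  hφt : ∀ z ∈ Sph n, ∀ t : ℝ, 0 ≤ t → HasDerivAt (φ z) (φt z t) t
  φt_neg : ∀ z ∈ Sph n, ∀ t : ℝ, 0 ≤ t → φt z t < 0
  speed_nonincreasing : ∀ z ∈ Sph n, ∀ s t : ℝ, 0 ≤ s → s ≤ t → φt z s ≤ φt z t
  μ : Fin n → ES n → ℝ → ℝ
  μ_pos : ∀ i, ∀ z ∈ Sph n, ∀ t : ℝ, 0 ≤ t → 0 < μ i z t
  μ_eigen : ∀ z ∈ Sph n, ∀ t : ℝ, 0 ≤ t → ∃ e : Fin n → ES n, Orthonormal ℝ e ∧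
    (∀ i, ⟪e i, z⟫ = 0) ∧
    ∀ i (v : ES n), hbil (fun x => φ x t) z (e i) v = (μ i z t)⁻¹ * ⟪e i, v⟫
  μ_mono : ∀ i, ∀ z ∈ Sph n, ∀ s t : ℝ, 0 ≤ s → s ≤ t → μ i z s ≤ μ i z t
  μ_bdd : ∃ M : ℝ, ∀ i, ∀ z ∈ Sph n, ∀ t : ℝ, 0 ≤ t → μ i z t ≤ M
  interior_point : ∃ ρ : ℝ, 0 < ρ ∧ ∀ z ∈ Sph n, ∀ t : ℝ, 0 ≤ t → ρ ≤ φ z t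

/-- The penalty function `β_δ(x) = C₀β(x/δ)`: smooth, non-decreasing, concave, vanishing on
`[δ,∞)`, affine on `(−∞,0)`, with `β_δ(0) = −C₀`. -/
structure Penalty (δ C₀ : ℝ) : Type where
  β : ℝ → ℝ
  smooth : ContDiff ℝ (⊤ : ℕ∞) β
  mono : Monotone β
  concave : ConcaveOn ℝ Set.univ β
  zero_of_ge : ∀ x : ℝ, δ ≤ x → β x = 0
  affine_on_neg : ∀ x : ℝ, x < 0 → deriv (deriv β) x = 0
  at_zero : β 0 = -C₀

/-- `C₀ = ‖K_Φ‖_{L^∞(𝕊ⁿ×[0,∞))}^α`, where `K_Φ = μ₁⋯μ_n` is the Gauss curvature of the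
obstacle. -/
def PenaltyConst (n : ℕ) (α : ℝ) (Φ : ShrinkingObstacle n) (C₀ : ℝ) : Prop :=
  C₀ = sSup {y : ℝ | ∃ z ∈ Sph n, ∃ t : ℝ, 0 ≤ t ∧ y = (∏ i, Φ.μ i z t) ^ α}

/-- A smooth solution of the penalized problem `(∗_δ)` on `[0,T)`:
`−∂_t u = K^α + β_δ(u − φ)`, where `u(·,t)` is the (1-homogeneously extended) support
function of a closed strictly convex smooth hypersurface `Σ_t` and
`K = (suppHessDet)⁻¹` is its Gauss curvature. -/
structure IsPenalizedSol (n : ℕ) (α T δ C₀ : ℝ) (Φ : ShrinkingObstacle n)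
    (P : Penalty δ C₀) (u : ES n → ℝ → ℝ) : Prop where
  homog : ∀ t ∈ Set.Ico (0 : ℝ) T, ∀ c : ℝ, 0 < c → ∀ x, u (c • x) t = c * u x t
  smooth : ContDiffOn ℝ (⊤ : ℕ∞) (fun p : ES n × ℝ => u p.1 p.2) ({(0 : ES n)}ᶜ ×ˢ Set.Ico 0 T)
  strict_convex : ∀ t ∈ Set.Ico (0 : ℝ) T, ∀ z ∈ Sph n, ∀ v : ES n,
    ⟪v, z⟫ = 0 → v ≠ 0 → 0 < hbil (fun x => u x t) z v v
  eqn : ∀ z ∈ Sph n, ∀ t ∈ Set.Ioo (0 : ℝ) T,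
    HasDerivAt (u z)
      (-((suppHessDet n (fun x => u x t) z) ^ (-α)) - P.β (u z t - Φ.φ z t)) t

/-- The initial hypersurface (with support function `u₀`) strictly encloses the obstacle,
together with the standing normalization `−∂_tφ(·,0) < min_{𝕊ⁿ} K₀^α` and
`−∂_tφ(·,0) < min_{𝕊ⁿ} K_{Φ₀}^α`. -/
def Encloses (n : ℕ) (α : ℝ) (u₀ : ES n → ℝ) (Φ : ShrinkingObstacle n) : Prop :=
  (∀ z ∈ Sph n, Φ.φ z 0 < u₀ z) ∧
    (∀ z ∈ Sph n, ∀ z' ∈ Sph n, -Φ.φt z 0 < ((suppHessDet n u₀ z')⁻¹) ^ α) ∧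
    (∀ z ∈ Sph n, ∀ z' ∈ Sph n, -Φ.φt z 0 < (∏ i, Φ.μ i z' 0) ^ α)

section MatrixLemmas
open Matrix
open scoped MatrixOrder

variable {ι : Type*} [Fintype ι] [DecidableEq ι]

lemma Matrix.PosSemidef.exists_eq_conjTranspose_mul {A : Matrix ι ι ℝ} (hA : A.PosSemidef) :
    ∃ C : Matrix ι ι ℝ, A = Cᴴ * C := by
  have h : (0 : Matrix ι ι ℝ) ≤ A := Matrix.nonneg_iff_posSemidef.2 hA
  obtain ⟨C, hC⟩ := CStarAlgebra.nonneg_iff_eq_star_mul_self.1 h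
  exact ⟨C, hC⟩

lemma Matrix.PosSemidef.trace_mul_nonneg {A B : Matrix ι ι ℝ} (hA : A.PosSemidef)
    (hB : B.PosSemidef) : 0 ≤ (A * B).trace := by
  obtain ⟨C, rfl⟩ := hA.exists_eq_conjTranspose_mul
  rw [Matrix.mul_assoc, Matrix.trace_mul_comm]
  exact (hB.mul_mul_conjTranspose_same C).trace_nonneg

lemma Matrix.PosSemidef.eigenvalue_le_trace {A : Matrix ι ι ℝ} (hA : A.PosSemidef) (i : ι) :
    hA.isHermitian.eigenvalues i ≤ A.trace := by
  rw [hA.isHermitian.trace_eq_sum_eigenvalues]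
  exact Finset.single_le_sum (f := fun i => hA.isHermitian.eigenvalues i)
    (fun j _ => hA.eigenvalues_nonneg j) (Finset.mem_univ i)

lemma Matrix.PosSemidef.det_le_trace_pow {A : Matrix ι ι ℝ} (hA : A.PosSemidef) :
    A.det ≤ A.trace ^ Fintype.card ι := by
  rw [hA.isHermitian.det_eq_prod_eigenvalues]
  refine (Finset.prod_le_prod (fun i _ => hA.eigenvalues_nonneg i)
    (fun i _ => hA.eigenvalue_le_trace i)).trans ?_
  simp

lemma Matrix.PosSemidef.one_le_det_one_add {A : Matrix ι ι ℝ} (hA : A.PosSemidef) :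
    1 ≤ (1 + A).det := by
  have hB : (1 + A).PosSemidef := Matrix.PosSemidef.one.add hA
  rw [hB.isHermitian.det_eq_prod_eigenvalues]
  suffices h : ∀ i, 1 ≤ hB.isHermitian.eigenvalues i by
    simpa using Finset.prod_le_prod (s := Finset.univ) (f := fun _ : ι => (1 : ℝ))
      (fun _ _ => zero_le_one) (fun i _ => h i)
  intro i
  set v := hB.isHermitian.eigenvectorBasis i
  have hv : (1 + A) *ᵥ v.ofLp = hB.isHermitian.eigenvalues i • v.ofLp :=
    hB.isHermitian.mulVec_eigenvectorBasis i
  have hn : v.ofLp ⬝ᵥ v.ofLp = 1 := by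
    have := hB.isHermitian.eigenvectorBasis.orthonormal.1 i
    have h2 : ⟪v, v⟫ = 1 := by rw [real_inner_self_eq_norm_sq, this]; norm_num
    simpa only [EuclideanSpace.inner_eq_star_dotProduct, star_trivial] using h2
  have h := hA.dotProduct_mulVec_nonneg v.ofLp
  have h2 := congrArg (fun w => v.ofLp ⬝ᵥ w) hv
  simp only [add_mulVec, one_mulVec, dotProduct_add, dotProduct_smul, hn] at h2
  simp only [star_trivial, smul_eq_mul, mul_one] at h h2
  linarith

lemma Matrix.PosDef.det_le_det_add {A P : Matrix ι ι ℝ} (hA : A.PosDef) (hP : P.PosSemidef) :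
    A.det ≤ (A + P).det := by
  obtain ⟨C, rfl⟩ := hA.posSemidef.exists_eq_conjTranspose_mul
  have hd := hA.det_pos
  have hC : IsUnit C.det := by
    rw [det_mul] at hd
    exact isUnit_iff_ne_zero.2 fun h => by simp [h] at hd
  have hC' : IsUnit Cᴴ.det := by rw [det_conjTranspose]; simpa using hC
  have key : Cᴴ * C + P = Cᴴ * (1 + (C⁻¹)ᴴ * P * C⁻¹) * C := by
    rw [Matrix.mul_add, Matrix.add_mul, Matrix.mul_one, conjTranspose_nonsing_inv]
    congr 1
    rw [Matrix.mul_assoc, Matrix.mul_assoc, Matrix.mul_assoc, nonsing_inv_mul _ hC,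
      Matrix.mul_one, ← Matrix.mul_assoc, mul_nonsing_inv _ hC', Matrix.one_mul]
  have h1 := (hP.conjTranspose_mul_mul_same C⁻¹).one_le_det_one_add
  have : (Cᴴ * C + P).det = (Cᴴ * C).det * (1 + (C⁻¹)ᴴ * P * C⁻¹).det := by
    rw [key]; simp only [det_mul]; ring
  rw [this]
  nlinarith

lemma Matrix.det_eq_prod_of_eigenbasis {A E : Matrix ι ι ℝ} {d : ι → ℝ} (hE : E.det ≠ 0)
    (h : A * E = E * diagonal d) : A.det = ∏ i, d i := by
  have := congrArg det h
  rw [det_mul, det_mul, det_diagonal, mul_comm] at this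
  exact mul_left_cancel₀ hE this

lemma HasDerivAt.matrix_det {A : ℝ → Matrix ι ι ℝ} {A' : Matrix ι ι ℝ} {t : ℝ}
    (hA : ∀ i j, HasDerivAt (fun s => A s i j) (A' i j) t) (hdet : (A t).det ≠ 0) :
    HasDerivAt (fun s => (A s).det) ((A t).det * ((A t)⁻¹ * A').trace) t := by
  have hdiff : Differentiable ℝ (fun M : ι → ι → ℝ => (Matrix.of M).det) := by
    simp only [det_apply, of_apply]
    fun_prop
  have hA2 : HasDerivAt (fun s => (fun i j => A s i j : ι → ι → ℝ)) (fun i j => A' i j) t :=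
    hasDerivAt_pi.2 fun i => hasDerivAt_pi.2 fun j => hA i j
  have h1 := ((hdiff (fun i j => A t i j)).hasFDerivAt.comp_hasDerivAt t hA2)
  have h2 : HasDerivAt (fun s : ℝ => (fun i j => A t i j + s * A' i j : ι → ι → ℝ))
      (fun i j => A' i j) 0 :=
    hasDerivAt_pi.2 fun i => hasDerivAt_pi.2 fun j => by
      simpa using ((hasDerivAt_id (0 : ℝ)).mul_const (A' i j)).const_add (A t i j)
  have h3 := HasFDerivAt.comp_hasDerivAt (x := (0:ℝ))
    (f := fun s : ℝ => (fun i j => A t i j + s * A' i j : ι → ι → ℝ))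
    (l := fun M : ι → ι → ℝ => (Matrix.of M).det)
    (by simpa using (hdiff (fun i j => A t i j)).hasFDerivAt) h2
  have hu : IsUnit (A t).det := isUnit_iff_ne_zero.2 hdet
  have h4 : HasDerivAt (fun s : ℝ => (A t).det * (1 + s • ((A t)⁻¹ * A')).det)
      ((A t).det * ((A t)⁻¹ * A').trace) 0 := by
    refine HasDerivAt.const_mul _ ?_
    have h5 : HasDerivAt (fun s : ℝ => 1 + (((A t)⁻¹ * A').trace) * s +
        ((det (1 + (Polynomial.X : Polynomial ℝ) •
          ((A t)⁻¹ * A').map Polynomial.C)).divX.divX.eval s) * s ^ 2)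
        (((A t)⁻¹ * A').trace) 0 := by
      have ha := ((hasDerivAt_id (0:ℝ)).const_mul (((A t)⁻¹ * A').trace)).const_add 1
      have hb := ((det (1 + (Polynomial.X : Polynomial ℝ) •
          ((A t)⁻¹ * A').map Polynomial.C)).divX.divX.hasDerivAt 0).mul
        (hasDerivAt_pow 2 (0:ℝ))
      refine (ha.add hb).congr_deriv ?_
      simp
    exact h5.congr_of_eventuallyEq (Filter.Eventually.of_forall fun s => det_one_add_smul s _)
  have h6 := h3.unique (h4.congr_of_eventuallyEq (Filter.Eventually.of_forall fun s => by
    simp only [Function.comp]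
    rw [← det_mul, Matrix.mul_add, Matrix.mul_one, Matrix.mul_smul, ← Matrix.mul_assoc,
      mul_nonsing_inv _ hu, Matrix.one_mul]
    congr 1))
  rw [← h6]
  exact h1
end MatrixLemmas

section Calculus
open Filter Topology
open scoped ContDiff

variable {E : Type*} [NormedAddCommGroup E] [NormedSpace ℝ E]

lemma hbil_eq_fderiv_fderiv {f : E → ℝ} {z : E} (hf : ContDiffAt ℝ 2 f z) (v w : E) :
    hbil f z v w = fderiv ℝ (fderiv ℝ f) z v w := by
  have h : DifferentiableAt ℝ (fderiv ℝ f) z :=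
    (hf.fderiv_right (m := 1) (by norm_num)).differentiableAt one_ne_zero
  unfold hbil
  rw [fderiv_clm_apply h (differentiableAt_const w)]
  simp

lemma hbil_comm {f : E → ℝ} {z : E} (hf : ContDiffAt ℝ 2 f z) (v w : E) :
    hbil f z v w = hbil f z w v := by
  rw [hbil_eq_fderiv_fderiv hf, hbil_eq_fderiv_fderiv hf]
  exact hf.isSymmSndFDerivAt (by simp) v w

lemma hbil_congr {f g : E → ℝ} {z : E} (h : f =ᶠ[𝓝 z] g) (v w : E) :
    hbil f z v w = hbil g z v w := by
  have h' : (fun x => fderiv ℝ f x w) =ᶠ[𝓝 z] fun x => fderiv ℝ g x w :=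
    (h.fderiv (𝕜 := ℝ)).mono fun x hx => by simp only [hx]
  unfold hbil
  rw [h'.fderiv_eq]

lemma hbil_add {f g : E → ℝ} {z : E} (hf : ContDiffAt ℝ 2 f z) (hg : ContDiffAt ℝ 2 g z)
    (v w : E) : hbil (fun x => f x + g x) z v w = hbil f z v w + hbil g z v w := by
  have h : (fun x => fderiv ℝ (fun x => f x + g x) x w) =ᶠ[𝓝 z]
      fun x => fderiv ℝ f x w + fderiv ℝ g x w := by
    filter_upwards [hf.eventually (by simp), hg.eventually (by simp)] with x hx hy
    rw [fderiv_fun_add (hx.differentiableAt two_ne_zero) (hy.differentiableAt two_ne_zero)]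
    simp
  have hd : ∀ {k : E → ℝ}, ContDiffAt ℝ 2 k z → DifferentiableAt ℝ (fun x => fderiv ℝ k x w) z :=
    fun hk => ((hk.fderiv_right (m := 1) (by norm_num)).differentiableAt one_ne_zero).clm_apply
      (differentiableAt_const w)
  unfold hbil
  rw [h.fderiv_eq, fderiv_fun_add (hd hf) (hd hg)]
  simp

lemma hbil_const_mul (f : E → ℝ) (z : E) (c : ℝ) (v w : E) :
    hbil (fun x => c * f x) z v w = c * hbil f z v w := by
  have h : ∀ k : E → ℝ, fderiv ℝ (fun x => c * k x) = fun x => c • fderiv ℝ k x := by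
    intro k
    funext x
    exact congrFun (fderiv_const_smul_field (f := k) (𝕜 := ℝ) c) x
  unfold hbil
  simp only [h, FunLike.coe_smul, Pi.smul_apply, smul_eq_mul]

lemma hbil_nonpos_of_isLocalMax {f : E → ℝ} {z : E} (hf : ContDiffAt ℝ 2 f z)
    (hmax : IsLocalMax f z) (v : E) : hbil f z v v ≤ 0 := by
  set k : ℝ → ℝ := fun s => f (z + s • v) with hk
  have hline : ∀ s : ℝ, HasDerivAt (fun s : ℝ => z + s • v) v s := fun s => by
    simpa using ((hasDerivAt_id s).smul_const v).const_add z
  have hcont : Tendsto (fun s : ℝ => z + s • v) (𝓝 0) (𝓝 z) := by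
    simpa using (hline 0).continuousAt.tendsto
  have hk0 : k 0 = f z := by simp [hk]
  have hkmax : IsLocalMax k 0 := by
    filter_upwards [hcont.eventually hmax] with s hs
    rw [hk0]; exact hs
  have hd1 : deriv k =ᶠ[𝓝 0] fun s => fderiv ℝ f (z + s • v) v := by
    filter_upwards [hcont.eventually (hf.eventually (by simp))] with s hs
    exact ((hs.differentiableAt two_ne_zero).hasFDerivAt.comp_hasDerivAt s (hline s)).deriv
  have hd : DifferentiableAt ℝ (fun x => fderiv ℝ f x v) z :=
    ((hf.fderiv_right (m := 1) (by norm_num)).differentiableAt one_ne_zero).clm_apply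
      (differentiableAt_const v)
  have hd2 : deriv (deriv k) 0 = hbil f z v v := by
    rw [hd1.deriv_eq]
    refine (HasFDerivAt.comp_hasDerivAt (x := (0 : ℝ)) (f := fun s : ℝ => z + s • v)
      (l := fun x => fderiv ℝ f x v) ?_ (hline 0)).deriv
    simpa using hd.hasFDerivAt
  by_contra! hpos
  have hkmin : IsLocalMin k 0 := by
    refine isLocalMin_of_deriv_deriv_pos (by rw [hd2]; exact hpos) hkmax.deriv_eq_zero ?_
    have : ContinuousAt f (z + (0 : ℝ) • v) := by simpa using hf.continuousAt
    exact ContinuousAt.comp (f := fun s : ℝ => z + s • v) this (hline 0).continuousAt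
  have hconst : k =ᶠ[𝓝 0] fun _ => k 0 := by
    filter_upwards [hkmax, hkmin] with s h1 h2
    exact le_antisymm h1 h2
  have h2 : deriv (deriv k) 0 = 0 := by
    rw [hconst.deriv.deriv_eq]
    simp
  linarith

/-- The partial derivative in the space direction `w` of a function on space-time. -/
def spaceDeriv (f : E × ℝ → ℝ) (w : E) (p : E × ℝ) : ℝ :=
  fderiv ℝ (fun x => f (x, p.2)) p.1 w

/-- The time derivative of a function on space-time. -/
def timeDeriv (f : E × ℝ → ℝ) (p : E × ℝ) : ℝ := fderiv ℝ f p (0, 1)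

lemma hasFDerivAt_slice {f : E × ℝ → ℝ} {U : Set E} {I : Set ℝ} (hU : IsOpen U)
    (hf : DifferentiableOn ℝ f (U ×ˢ I)) {p : E × ℝ} (hp : p ∈ U ×ˢ I) :
    HasFDerivAt (fun x => f (x, p.2))
      ((fderivWithin ℝ f (U ×ˢ I) p).comp (ContinuousLinearMap.inl ℝ E ℝ)) p.1 := by
  have h1 : HasFDerivWithinAt f (fderivWithin ℝ f (U ×ˢ I) p) (U ×ˢ I) (p.1, p.2) :=
    (hf p hp).hasFDerivWithinAt
  have h2 : HasFDerivWithinAt (fun x : E => (x, p.2)) (ContinuousLinearMap.inl ℝ E ℝ) U p.1 :=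
    (hasFDerivAt_prodMk_left p.1 p.2).hasFDerivWithinAt
  exact (h1.comp (f := fun x : E => (x, p.2)) p.1 h2 fun x hx => ⟨hx, hp.2⟩).hasFDerivAt
    (hU.mem_nhds hp.1)

lemma contDiffOn_spaceDeriv {f : E × ℝ → ℝ} {U : Set E} {I : Set ℝ} (hU : IsOpen U)
    (hI : UniqueDiffOn ℝ I) (hf : ContDiffOn ℝ ∞ f (U ×ˢ I)) (w : E) :
    ContDiffOn ℝ ∞ (spaceDeriv f w) (U ×ˢ I) := by
  have h1 : ContDiffOn ℝ ∞ (fun p => fderivWithin ℝ f (U ×ˢ I) p (w, 0)) (U ×ˢ I) :=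
    (hf.fderivWithin (hU.uniqueDiffOn.prod hI) (by simp)).clm_apply contDiffOn_const
  refine h1.congr fun p hp => ?_
  have := (hasFDerivAt_slice hU (hf.differentiableOn (by simp)) hp).fderiv
  simp [spaceDeriv, this]

lemma spaceDeriv_eq_fderiv {f : E × ℝ → ℝ} {p : E × ℝ} (hf : DifferentiableAt ℝ f p) (w : E) :
    spaceDeriv f w p = fderiv ℝ f p (w, 0) := by
  have h : HasFDerivAt (fun x => f (x, p.2)) ((fderiv ℝ f p).comp (ContinuousLinearMap.inl ℝ E ℝ))
      p.1 := HasFDerivAt.comp (g := f) (f := fun x : E => (x, p.2)) p.1 hf.hasFDerivAt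
        (hasFDerivAt_prodMk_left p.1 p.2)
  simp [spaceDeriv, h.fderiv]

lemma hasDerivAt_timeDeriv {f : E × ℝ → ℝ} {z : E} {t : ℝ} (hf : DifferentiableAt ℝ f (z, t)) :
    HasDerivAt (fun s => f (z, s)) (timeDeriv f (z, t)) t :=
  hf.hasFDerivAt.comp_hasDerivAt t ((hasDerivAt_const t z).prodMk (hasDerivAt_id t))

lemma contDiffOn_timeDeriv {f : E × ℝ → ℝ} {O : Set (E × ℝ)} (hO : IsOpen O)
    (hf : ContDiffOn ℝ ∞ f O) : ContDiffOn ℝ ∞ (timeDeriv f) O :=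
  (hf.fderiv_of_isOpen hO (by simp)).clm_apply contDiffOn_const

lemma timeDeriv_spaceDeriv {f : E × ℝ → ℝ} {O : Set (E × ℝ)} (hO : IsOpen O)
    (hf : ContDiffOn ℝ ∞ f O) {p : E × ℝ} (hp : p ∈ O) (w : E) :
    timeDeriv (spaceDeriv f w) p = spaceDeriv (timeDeriv f) w p := by
  have hfp : ContDiffAt ℝ ∞ f p := hf.contDiffAt (hO.mem_nhds hp)
  have h1 : spaceDeriv f w =ᶠ[𝓝 p] fun q => fderiv ℝ f q (w, 0) := by
    filter_upwards [hO.mem_nhds hp] with q hq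
    exact spaceDeriv_eq_fderiv ((hf.contDiffAt (hO.mem_nhds hq)).differentiableAt (by simp)) w
  rw [spaceDeriv_eq_fderiv (((contDiffOn_timeDeriv hO hf).contDiffAt
    (hO.mem_nhds hp)).differentiableAt (by simp)), timeDeriv, h1.fderiv_eq]
  exact hbil_comm (hfp.of_le (WithTop.coe_le_coe.2 (le_top : (2 : ℕ∞) ≤ ⊤))) (0, 1) (w, 0)

lemma hasDerivAt_hbil_slice {f : E × ℝ → ℝ} {U : Set E} {J : Set ℝ} (hU : IsOpen U)
    (hJ : IsOpen J) (hf : ContDiffOn ℝ ∞ f (U ×ˢ J)) {z : E} {t : ℝ} (hz : z ∈ U) (ht : t ∈ J)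
    (v w : E) :
    HasDerivAt (fun s => hbil (fun x => f (x, s)) z v w)
      (hbil (fun x => timeDeriv f (x, t)) z v w) t := by
  have hO := hU.prod hJ
  have hg := contDiffOn_spaceDeriv hU hJ.uniqueDiffOn hf w
  have hg2 := contDiffOn_spaceDeriv hU hJ.uniqueDiffOn hg v
  have hp : (z, t) ∈ U ×ˢ J := ⟨hz, ht⟩
  have h1 := hasDerivAt_timeDeriv ((hg2.contDiffAt (hO.mem_nhds hp)).differentiableAt (by simp))
  refine h1.congr_deriv ?_
  rw [timeDeriv_spaceDeriv hO hg hp]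
  have h2 : (fun x => timeDeriv (spaceDeriv f w) (x, t)) =ᶠ[𝓝 z]
      fun x => spaceDeriv (timeDeriv f) w (x, t) := by
    filter_upwards [hU.mem_nhds hz] with x hx
    exact timeDeriv_spaceDeriv hO hf ⟨hx, ht⟩ w
  simp only [spaceDeriv, hbil]
  rw [h2.fderiv_eq]
  rfl

lemma continuousOn_hbil_slice {f : E × ℝ → ℝ} {U : Set E} {I : Set ℝ} (hU : IsOpen U)
    (hI : UniqueDiffOn ℝ I) (hf : ContDiffOn ℝ ∞ f (U ×ˢ I)) (v w : E) :
    ContinuousOn (fun p : E × ℝ => hbil (fun x => f (x, p.2)) p.1 v w) (U ×ˢ I) :=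
  (contDiffOn_spaceDeriv hU hI (contDiffOn_spaceDeriv hU hI hf w) v).continuousOn

lemma contDiffAt_slice {f : E × ℝ → ℝ} {U : Set E} {I : Set ℝ} (hU : IsOpen U) {m : WithTop ℕ∞}
    (hf : ContDiffOn ℝ m f (U ×ˢ I)) {z : E} {t : ℝ} (hz : z ∈ U) (ht : t ∈ I) :
    ContDiffAt ℝ m (fun x => f (x, t)) z := by
  have : ContDiffOn ℝ m (fun x : E => f (x, t)) U :=
    hf.comp (contDiff_id.prodMk contDiff_const).contDiffOn fun x hx => ⟨hx, ht⟩
  exact this.contDiffAt (hU.mem_nhds hz)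

/-- The second derivative of a function that is positively homogeneous of degree one annihilates
the radial direction. -/
lemma hbil_radial_left {f : E → ℝ} (hhom : ∀ c : ℝ, 0 < c → ∀ x, f (c • x) = c * f x) {z : E}
    (hf : ContDiffAt ℝ 2 f z) (w : E) : hbil f z z w = 0 := by
  have hd : DifferentiableAt ℝ (fun x => fderiv ℝ f x w) z :=
    ((hf.fderiv_right (m := 1) (by norm_num)).differentiableAt one_ne_zero).clm_apply
      (differentiableAt_const w)
  have hray : ∀ c : ℝ, 0 < c → fderiv ℝ f (c • z) w = fderiv ℝ f z w := by
    intro c hc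
    have h1 : fderiv ℝ (fun x => f (c • x)) z = c • fderiv ℝ f (c • z) := by
      simpa using fderiv_comp_smul (f := f) (x := z) c
    have h2 : fderiv ℝ (fun x => f (c • x)) z = c • fderiv ℝ f z := by
      rw [funext (hhom c hc)]
      exact congrFun (fderiv_const_smul_field (f := f) (𝕜 := ℝ) c) z
    have h3 := congrArg (fun L : E →L[ℝ] ℝ => L w) (h1.symm.trans h2)
    simp only [FunLike.coe_smul, Pi.smul_apply, smul_eq_mul] at h3
    exact mul_left_cancel₀ hc.ne' h3
  have hline : HasDerivAt (fun c : ℝ => c • z) z 1 := by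
    simpa using (hasDerivAt_id (1 : ℝ)).smul_const z
  have h4 : HasDerivAt (fun c : ℝ => fderiv ℝ f (c • z) w) (hbil f z z w) 1 :=
    HasFDerivAt.comp_hasDerivAt (x := (1 : ℝ)) (f := fun c : ℝ => c • z)
      (l := fun x => fderiv ℝ f x w) (by simpa using hd.hasFDerivAt) hline
  have h5 : (fun c : ℝ => fderiv ℝ f (c • z) w) =ᶠ[𝓝 1] fun _ => fderiv ℝ f z w := by
    filter_upwards [lt_mem_nhds (zero_lt_one (α := ℝ))] with c hc
    exact hray c hc
  exact h4.unique ((hasDerivAt_const (1 : ℝ) _).congr_of_eventuallyEq h5)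

lemma deriv_nonneg_of_le_left {h : ℝ → ℝ} {d t₀ : ℝ} (hd : HasDerivAt h d t₀) (ht₀ : 0 < t₀)
    (hle : ∀ t, 0 < t → t < t₀ → h t ≤ h t₀) : 0 ≤ d := by
  have h1 : Tendsto (slope h t₀) (𝓝[<] t₀) (𝓝 d) :=
    (hasDerivAt_iff_tendsto_slope.1 hd).mono_left (nhdsWithin_mono _ fun x hx => ne_of_lt hx)
  refine ge_of_tendsto h1 ?_
  filter_upwards [Ioo_mem_nhdsLT ht₀] with t ht
  rw [slope_def_field]
  exact div_nonneg_of_nonpos (by linarith [hle t ht.1 ht.2]) (by linarith [ht.2])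

end Calculus

section Norm
variable {F : Type*} [NormedAddCommGroup F] [InnerProductSpace ℝ F]
open Filter Topology

lemma hbil_norm {z : F} (hz : ‖z‖ = 1) (v w : F) :
    hbil (fun x : F => ‖x‖) z v w = ⟪v, w⟫ - ⟪z, v⟫ * ⟪z, w⟫ := by
  have hn : ∀ x : F, x ≠ 0 → HasFDerivAt (fun x : F => ‖x‖) ((‖x‖)⁻¹ • innerSL ℝ x) x := by
    intro x hx
    have h1 := (hasStrictFDerivAt_norm_sq x).hasFDerivAt.sqrt (by simpa using hx)
    simp only [Real.sqrt_sq (norm_nonneg _)] at h1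
    refine h1.congr_fderiv ?_
    ext y
    simp
    ring
  have hz0 : z ≠ 0 := fun h => by simp [h] at hz
  have h2 : (fun x => fderiv ℝ (fun x : F => ‖x‖) x w) =ᶠ[𝓝 z] fun x => ‖x‖⁻¹ * ⟪x, w⟫ := by
    filter_upwards [isOpen_ne.mem_nhds hz0] with x hx
    rw [(hn x hx).fderiv]
    simp
  have h3 : HasFDerivAt (fun x : F => ⟪x, w⟫) (innerSL ℝ w) z := by
    refine (innerSL ℝ w).hasFDerivAt.congr_of_eventuallyEq (Eventually.of_forall fun x => ?_)
    simp [real_inner_comm]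
  have h4 := (hasDerivAt_inv (x := ‖z‖) (by simp [hz])).comp_hasFDerivAt z (hn z hz0)
  have h5 : HasFDerivAt (fun x : F => ‖x‖⁻¹ * ⟪x, w⟫) _ z := h4.mul h3
  unfold hbil
  rw [h2.fderiv_eq, h5.fderiv]
  simp [hz, real_inner_comm]
  ring

end Norm

section Hessian
open Matrix Filter Topology
open scoped ContDiff

/-- The Hessian matrix of `f` at `z` in the standard basis. -/
def hessMatrix (n : ℕ) (f : ES n → ℝ) (z : ES n) : Matrix (Fin (n + 1)) (Fin (n + 1)) ℝ :=
  Matrix.of fun i j => hbil f z (EuclideanSpace.single i 1) (EuclideanSpace.single j 1)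

/-- The matrix of `z ⊗ z`. -/
def radialMatrix (n : ℕ) (z : ES n) : Matrix (Fin (n + 1)) (Fin (n + 1)) ℝ :=
  Matrix.of fun i j => ⟪z, EuclideanSpace.single i 1⟫ * ⟪z, EuclideanSpace.single j 1⟫

lemma suppHessDet_eq_det (n : ℕ) (U : ES n → ℝ) (z : ES n) :
    suppHessDet n U z = (hessMatrix n U z + radialMatrix n z).det := rfl

lemma inner_single_one {n : ℕ} (z : ES n) (i : Fin (n + 1)) :
    ⟪z, EuclideanSpace.single i (1 : ℝ)⟫ = z i := by
  simp [EuclideanSpace.inner_single_right]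

lemma sum_smul_single {n : ℕ} (x : Fin (n + 1) → ℝ) :
    ∑ i, x i • EuclideanSpace.single i (1 : ℝ) = (WithLp.toLp 2 x : ES n) := by
  ext j
  simp [Pi.single_apply]

lemma bilin_toLp {n : ℕ} (B : ES n →L[ℝ] ES n →L[ℝ] ℝ) (x y : Fin (n + 1) → ℝ) :
    x ⬝ᵥ (Matrix.of fun i j => B (EuclideanSpace.single i 1) (EuclideanSpace.single j 1)) *ᵥ y =
      B (WithLp.toLp 2 x) (WithLp.toLp 2 y) := by
  rw [← sum_smul_single x, ← sum_smul_single y]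
  simp only [map_sum, map_smul, _root_.sum_apply, FunLike.coe_smul,
    Pi.smul_apply, smul_eq_mul, dotProduct, mulVec, of_apply, Finset.mul_sum]
  rw [Finset.sum_comm]
  refine Finset.sum_congr rfl fun j _ => Finset.sum_congr rfl fun i _ => ?_
  ring

lemma dotProduct_hessMatrix_mulVec {n : ℕ} {f : ES n → ℝ} {z : ES n} (hf : ContDiffAt ℝ 2 f z)
    (x y : Fin (n + 1) → ℝ) :
    x ⬝ᵥ hessMatrix n f z *ᵥ y = hbil f z (WithLp.toLp 2 x) (WithLp.toLp 2 y) := by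
  rw [hbil_eq_fderiv_fderiv hf, ← bilin_toLp]
  simp only [hessMatrix, hbil_eq_fderiv_fderiv hf]

lemma dotProduct_radialMatrix_mulVec {n : ℕ} (z : ES n) (x y : Fin (n + 1) → ℝ) :
    x ⬝ᵥ radialMatrix n z *ᵥ y = (x ⬝ᵥ z.ofLp) * (z.ofLp ⬝ᵥ y) := by
  have : radialMatrix n z = vecMulVec z.ofLp z.ofLp := by
    ext i j
    simp [radialMatrix, vecMulVec_apply, inner_single_one]
  rw [this, vecMulVec_mulVec]
  simp [dotProduct_smul, mul_comm]

lemma isHermitian_hessMatrix {n : ℕ} {f : ES n → ℝ} {z : ES n} (hf : ContDiffAt ℝ 2 f z) :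
    (hessMatrix n f z).IsHermitian := by
  ext i j
  simp [hessMatrix, hbil_comm hf (EuclideanSpace.single i 1)]

lemma posSemidef_radialMatrix (n : ℕ) (z : ES n) : (radialMatrix n z).PosSemidef := by
  refine Matrix.PosSemidef.of_dotProduct_mulVec_nonneg ?_ fun x => ?_
  · ext i j
    simp [radialMatrix, mul_comm]
  · rw [star_trivial, dotProduct_radialMatrix_mulVec, dotProduct_comm]
    exact mul_self_nonneg _

lemma posSemidef_hessMatrix {n : ℕ} {f : ES n → ℝ} {z : ES n} (hf : ContDiffAt ℝ 2 f z)
    (h : ∀ v, 0 ≤ hbil f z v v) : (hessMatrix n f z).PosSemidef :=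
  Matrix.PosSemidef.of_dotProduct_mulVec_nonneg (isHermitian_hessMatrix hf) fun x => by
    rw [star_trivial, dotProduct_hessMatrix_mulVec hf]
    exact h _

lemma hbil_tangential {n : ℕ} {f : ES n → ℝ} {z : ES n}
    (hhom : ∀ c : ℝ, 0 < c → ∀ x, f (c • x) = c * f x) (hf : ContDiffAt ℝ 2 f z) (v : ES n)
    (c : ℝ) : hbil f z (v - c • z) (v - c • z) = hbil f z v v := by
  have h1 := hbil_radial_left hhom hf
  have h2 : ∀ w, hbil f z w z = 0 := fun w => by rw [hbil_comm hf, h1]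
  simp only [hbil_eq_fderiv_fderiv hf] at h1 h2 ⊢
  simp [h1, h2]

lemma posDef_radii {n : ℕ} {f : ES n → ℝ} {z : ES n} (hz : ‖z‖ = 1)
    (hhom : ∀ c : ℝ, 0 < c → ∀ x, f (c • x) = c * f x) (hf : ContDiffAt ℝ 2 f z)
    (hconv : ∀ v : ES n, ⟪v, z⟫ = 0 → v ≠ 0 → 0 < hbil f z v v) :
    (hessMatrix n f z + radialMatrix n z).PosDef := by
  refine Matrix.PosDef.of_dotProduct_mulVec_pos
    ((isHermitian_hessMatrix hf).add (posSemidef_radialMatrix n z).isHermitian) fun x hx => ?_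
  rw [star_trivial, add_mulVec, dotProduct_add, dotProduct_hessMatrix_mulVec hf,
    dotProduct_radialMatrix_mulVec, dotProduct_comm x]
  set v : ES n := WithLp.toLp 2 x with hv
  have hc : z.ofLp ⬝ᵥ x = ⟪v, z⟫ := by
    rw [EuclideanSpace.inner_eq_star_dotProduct, star_trivial]
  rw [hc]
  have hv0 : v ≠ 0 := fun h => hx (by simpa [hv] using h)
  rw [← hbil_tangential hhom hf v ⟪v, z⟫]
  by_cases hw : v - ⟪v, z⟫ • z = 0
  · have : ⟪v, z⟫ ≠ 0 := fun h => hv0 (by simpa [h] using hw)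
    rw [hw, hbil_eq_fderiv_fderiv hf]
    simpa using mul_self_pos.2 this
  · have := hconv _ (by simp [inner_sub_left, inner_smul_left, hz]) hw
    nlinarith [mul_self_nonneg ⟪v, z⟫]

lemma radii_of_eigenbasis {n : ℕ} {f : ES n → ℝ} {z : ES n} (hz : ‖z‖ = 1)
    (hhom : ∀ c : ℝ, 0 < c → ∀ x, f (c • x) = c * f x) (hf : ContDiffAt ℝ 2 f z)
    {r : Fin n → ℝ} (hr : ∀ i, 0 < r i) {e : Fin n → ES n} (he : Orthonormal ℝ e)
    (hez : ∀ i, ⟪e i, z⟫ = 0) (heig : ∀ i v, hbil f z (e i) v = r i * ⟪e i, v⟫) :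
    (hessMatrix n f z + radialMatrix n z).PosDef ∧
      (hessMatrix n f z + radialMatrix n z).det = ∏ i, r i := by
  set b : Fin (n + 1) → ES n := Fin.cons z e with hb
  set d : Fin (n + 1) → ℝ := Fin.cons 1 r with hd
  set A := hessMatrix n f z + radialMatrix n z with hA
  set E : Matrix (Fin (n + 1)) (Fin (n + 1)) ℝ := Matrix.of fun i j => b j i with hE
  have hez' : ∀ i, ⟪z, e i⟫ = 0 := fun i => by rw [real_inner_comm, hez]
  have hbo : ∀ i j, ⟪b i, b j⟫ = if i = j then (1 : ℝ) else 0 := by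
    rw [orthonormal_iff_ite] at he
    intro i j
    refine Fin.cases ?_ (fun i => ?_) i <;> refine Fin.cases ?_ (fun j => ?_) j
    · simp [hb, hz]
    · simp [hb, hez', (Fin.succ_ne_zero j).symm]
    · simp [hb, hez, Fin.succ_ne_zero]
    · simp [hb, he]
  have hEE : Eᵀ * E = 1 := by
    ext i j
    rw [Matrix.one_apply, ← hbo i j, real_inner_comm]
    simp [Matrix.mul_apply, hE, PiLp.inner_apply]
  have hEE' : E * Eᵀ = 1 := mul_eq_one_comm.1 hEE
  have hAE : A * E = E * diagonal d := by
    ext k j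
    rw [mul_diagonal]
    have h1 : (A * E) k j = Pi.single k 1 ⬝ᵥ A *ᵥ (b j).ofLp := by
      simp [Matrix.mul_apply, hE, mulVec_eq_sum, single_dotProduct, mul_comm]
    have h2 : hbil f z (EuclideanSpace.single k 1) (b j) + z k * ⟪z, b j⟫ = b j k * d j := by
      rw [hbil_comm hf]
      refine Fin.cases ?_ (fun j => ?_) j
      · simp [hb, hd, hbil_radial_left hhom hf, hz]
      · simp [hb, hd, heig, hez', inner_single_one, mul_comm]
    rw [h1, hA, add_mulVec, dotProduct_add, dotProduct_hessMatrix_mulVec hf,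
      dotProduct_radialMatrix_mulVec]
    simp only [hE, of_apply]
    rw [← h2]
    congr 1
    rw [real_inner_comm (b j) z, EuclideanSpace.inner_eq_star_dotProduct]
    simp
  have hAeq : A = E * diagonal d * Eᴴ := by
    rw [← hAE, Matrix.mul_assoc, conjTranspose_eq_transpose_of_trivial, hEE', Matrix.mul_one]
  have hdpos : ∀ i, 0 < d i := Fin.cases (by simp [hd]) (fun i => by simpa [hd] using hr i)
  constructor
  · rw [hAeq]
    refine (Matrix.PosDef.diagonal hdpos).mul_mul_conjTranspose_same ?_
    intro x y hxy
    have := congrArg (fun w => w ᵥ* Eᵀ) hxy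
    simpa [vecMul_vecMul, hEE'] using this
  · have hdet : E.det ≠ 0 := fun h => by simpa [h] using congrArg det hEE
    rw [det_eq_prod_of_eigenbasis hdet hAE, Fin.prod_univ_succ]
    simp [hd]

lemma trace_inv_mul_hessMatrix_ge {n : ℕ} {f g : ES n → ℝ} {z : ES n} (hz : ‖z‖ = 1)
    (hf : ContDiffAt ℝ 2 f z) (hg : ContDiffAt ℝ 2 g z)
    (hA : (hessMatrix n f z + radialMatrix n z).PosDef) {lam ε : ℝ} (hlam : 0 ≤ lam)
    (hε : ε ≤ 1)
    (hmax : IsLocalMax (fun x => (-1) * g x + ((-lam) * f x + (lam * ε) * ‖x‖)) z) :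
    lam * (ε * (hessMatrix n f z + radialMatrix n z)⁻¹.trace - (n + 1)) ≤
      ((hessMatrix n f z + radialMatrix n z)⁻¹ * hessMatrix n g z).trace := by
  have hz0 : z ≠ 0 := fun h => by simp [h] at hz
  have hnorm : ContDiffAt ℝ 2 (fun x : ES n => ‖x‖) z := contDiffAt_norm ℝ hz0
  have c1 : ContDiffAt ℝ 2 (fun x => (-1) * g x) z := contDiffAt_const.mul hg
  have c2 : ContDiffAt ℝ 2 (fun x => (-lam) * f x) z := contDiffAt_const.mul hf
  have c3 : ContDiffAt ℝ 2 (fun x : ES n => (lam * ε) * ‖x‖) z := contDiffAt_const.mul hnorm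
  have c4 := c2.add c3
  have c5 : ContDiffAt ℝ 2 (fun x => (-1) * g x + ((-lam) * f x + (lam * ε) * ‖x‖)) z :=
    c1.add c4
  set A := hessMatrix n f z + radialMatrix n z with hAdef
  have hX := posSemidef_hessMatrix (f := fun x => (-1) *
      ((-1) * g x + ((-lam) * f x + (lam * ε) * ‖x‖))) (contDiffAt_const.mul c5) fun v => by
    rw [hbil_const_mul]
    linarith [hbil_nonpos_of_isLocalMax c5 hmax v]
  have hXeq : hessMatrix n (fun x => (-1) *
      ((-1) * g x + ((-lam) * f x + (lam * ε) * ‖x‖))) z =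
      hessMatrix n g z + lam • A - lam • radialMatrix n z
        - (lam * ε) • (1 : Matrix _ _ ℝ) + (lam * ε) • radialMatrix n z := by
    ext i j
    simp only [hessMatrix, of_apply, hbil_const_mul, hbil_add c1 c4, hbil_add c2 c3, hbil_norm hz,
      hAdef, Matrix.add_apply, Matrix.sub_apply, Matrix.smul_apply, smul_eq_mul, radialMatrix,
      Matrix.one_apply, inner_single_one, PiLp.single_apply, eq_comm (a := j)]
    ring
  rw [hXeq] at hX
  have h1 := hA.inv.posSemidef.trace_mul_nonneg hX
  have h2 := hA.inv.posSemidef.trace_mul_nonneg (posSemidef_radialMatrix n z)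
  have hu : IsUnit A.det := isUnit_iff_ne_zero.2 hA.det_pos.ne'
  simp only [Matrix.mul_add, Matrix.mul_sub, Matrix.mul_smul, trace_add, trace_sub, trace_smul,
    nonsing_inv_mul _ hu, Matrix.mul_one, trace_one, Fintype.card_fin, smul_eq_mul] at h1
  push_cast at h1
  nlinarith [mul_nonneg (mul_nonneg hlam (sub_nonneg.2 hε)) h2]

end Hessian

section Penalized
open Matrix Filter Topology Set
open scoped ContDiff

variable {n : ℕ} {α T δ C₀ : ℝ} {Φ : ShrinkingObstacle n} {P : Penalty δ C₀}
  {u : ES n → ℝ → ℝ}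

lemma norm_of_mem_sph {z : ES n} (hz : z ∈ Sph n) : ‖z‖ = 1 := by simpa [Sph] using hz

lemma ne_zero_of_mem_sph {z : ES n} (hz : z ∈ Sph n) : z ∈ ({(0 : ES n)}ᶜ : Set (ES n)) := by
  intro h
  rw [mem_singleton_iff] at h
  simpa [h] using norm_of_mem_sph hz

lemma normalize_mem_sph {x : ES n} (hx : x ≠ 0) : ‖x‖⁻¹ • x ∈ Sph n := by
  simp [Sph, norm_smul, hx]

lemma norm_smul_normalize {x : ES n} (hx : x ≠ 0) : ‖x‖ • (‖x‖⁻¹ • x) = x := by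
  rw [smul_smul, mul_inv_cancel₀ (norm_ne_zero_iff.2 hx), one_smul]

lemma isCompact_sph : IsCompact (Sph n) := isCompact_sphere 0 1

lemma Penalty.nonpos (P : Penalty δ C₀) (x : ℝ) : P.β x ≤ 0 := by
  rw [← P.zero_of_ge (max x δ) (le_max_right _ _)]
  exact P.mono (le_max_left _ _)

lemma Penalty.neg_le (P : Penalty δ C₀) {x : ℝ} (hx : 0 ≤ x) : -C₀ ≤ P.β x := by
  rw [← P.at_zero]
  exact P.mono hx

lemma ShrinkingObstacle.antitone (Φ : ShrinkingObstacle n) {z : ES n} (hz : z ∈ Sph n) :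
    AntitoneOn (Φ.φ z) (Ici 0) := by
  refine antitoneOn_of_deriv_nonpos (convex_Ici 0)
    (fun t ht => (Φ.hφt z hz t ht).continuousAt.continuousWithinAt) (fun t ht => ?_)
    (fun t ht => ?_)
  · rw [interior_Ici] at ht
    exact (Φ.hφt z hz t ht.le).differentiableAt.differentiableWithinAt
  · rw [interior_Ici] at ht
    rw [(Φ.hφt z hz t ht.le).deriv]
    exact (Φ.φt_neg z hz t ht.le).le

lemma ShrinkingObstacle.contDiffAt (Φ : ShrinkingObstacle n) {z : ES n} (hz : z ∈ Sph n) {t : ℝ}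
    (ht : 0 ≤ t) : ContDiffAt ℝ 2 (fun x => Φ.φ x t) z :=
  (contDiffAt_slice (f := fun p : ES n × ℝ => Φ.φ p.1 p.2) isOpen_compl_singleton Φ.smooth
    (ne_zero_of_mem_sph hz) ht).of_le (by norm_num)

lemma ShrinkingObstacle.radii (Φ : ShrinkingObstacle n) {z : ES n} (hz : z ∈ Sph n) {t : ℝ}
    (ht : 0 ≤ t) :
    (hessMatrix n (fun x => Φ.φ x t) z + radialMatrix n z).PosDef ∧
      (hessMatrix n (fun x => Φ.φ x t) z + radialMatrix n z).det = ∏ i, (Φ.μ i z t)⁻¹ := by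
  obtain ⟨e, he, hez, heig⟩ := Φ.μ_eigen z hz t ht
  exact radii_of_eigenbasis (norm_of_mem_sph hz) (Φ.homog t ht) (Φ.contDiffAt hz ht)
    (fun i => inv_pos.2 (Φ.μ_pos i z hz t ht)) he hez heig

lemma PenaltyConst.le (hC : PenaltyConst n α Φ C₀) (hα : 0 < α) {z : ES n} (hz : z ∈ Sph n)
    {t : ℝ} (ht : 0 ≤ t) : (∏ i, Φ.μ i z t) ^ α ≤ C₀ := by
  rw [hC]
  refine le_csSup ?_ ⟨z, hz, t, ht, rfl⟩
  obtain ⟨M, hM⟩ := Φ.μ_bdd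
  refine ⟨(M ^ n) ^ α, ?_⟩
  rintro y ⟨z, hz, t, ht, rfl⟩
  refine Real.rpow_le_rpow (Finset.prod_nonneg fun i _ => (Φ.μ_pos i z hz t ht).le) ?_ hα.le
  refine (Finset.prod_le_prod (fun i _ => (Φ.μ_pos i z hz t ht).le)
    (fun i _ => hM i z hz t ht)).trans ?_
  simp

namespace IsPenalizedSol

lemma contDiffAt (h : IsPenalizedSol n α T δ C₀ Φ P u) {z : ES n} (hz : z ∈ Sph n) {t : ℝ}
    (ht : t ∈ Ico 0 T) :
    ContDiffAt ℝ 2 (fun x => u x t) z :=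
  (contDiffAt_slice (f := fun p : ES n × ℝ => u p.1 p.2) isOpen_compl_singleton h.smooth
    (ne_zero_of_mem_sph hz) ht).of_le (WithTop.coe_le_coe.2 (le_top : (2 : ℕ∞) ≤ ⊤))

lemma posDef (h : IsPenalizedSol n α T δ C₀ Φ P u) {z : ES n} (hz : z ∈ Sph n) {t : ℝ}
    (ht : t ∈ Ico 0 T) :
    (hessMatrix n (fun x => u x t) z + radialMatrix n z).PosDef :=
  posDef_radii (norm_of_mem_sph hz) (h.homog t ht) (h.contDiffAt hz ht) (h.strict_convex t ht z hz)

lemma suppHessDet_pos (h : IsPenalizedSol n α T δ C₀ Φ P u) {z : ES n} (hz : z ∈ Sph n) {t : ℝ}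
    (ht : t ∈ Ico 0 T) :
    0 < suppHessDet n (fun x => u x t) z :=
  (h.posDef hz ht).det_pos

lemma continuousOn (h : IsPenalizedSol n α T δ C₀ Φ P u) :
    ContinuousOn (fun p : ES n × ℝ => u p.1 p.2) (Sph n ×ˢ Ico 0 T) :=
  h.smooth.continuousOn.mono (prod_mono (fun _ => ne_zero_of_mem_sph) subset_rfl)

lemma continuousOn_time (h : IsPenalizedSol n α T δ C₀ Φ P u) {z : ES n} (hz : z ∈ Sph n) :
    ContinuousOn (u z) (Ico 0 T) :=
  h.continuousOn.comp (f := fun t : ℝ => (z, t)) (by fun_prop) fun t ht => ⟨hz, ht⟩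

/-- The solution stays strictly above the obstacle. -/
lemma obstacle_lt (h : IsPenalizedSol n α T δ C₀ Φ P u) (hα : 0 < α) (hC : PenaltyConst n α Φ C₀)
    (h0 : ∀ z ∈ Sph n, Φ.φ z 0 < u z 0) {z : ES n} (hz : z ∈ Sph n) {t : ℝ} (ht : t ∈ Ico 0 T) :
    Φ.φ z t < u z t := by
  by_contra! hcon
  have hsub : Icc 0 t ⊆ Ico 0 T := fun s hs => ⟨hs.1, hs.2.trans_lt ht.2⟩
  set K := Sph n ×ˢ Icc 0 t with hK
  have hKc : IsCompact K := isCompact_sph.prod isCompact_Icc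
  have hφc : ContinuousOn (fun p : ES n × ℝ => Φ.φ p.1 p.2) K :=
    Φ.smooth.continuousOn.mono (prod_mono (fun _ => ne_zero_of_mem_sph) fun s hs => hs.1)
  have huc : ContinuousOn (fun p : ES n × ℝ => u p.1 p.2) K :=
    h.continuousOn.mono (prod_mono subset_rfl hsub)
  set S := K ∩ (fun p : ES n × ℝ => u p.1 p.2 - Φ.φ p.1 p.2) ⁻¹' Iic 0 with hS
  have hSc : IsCompact S :=
    hKc.of_isClosed_subset ((huc.sub hφc).preimage_isClosed_of_isClosed hKc.isClosed isClosed_Iic)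
      inter_subset_left
  obtain ⟨⟨z₀, t₀⟩, ⟨⟨hz₀, ht₀⟩, hle₀⟩, hmin⟩ := hSc.exists_isMinOn
    ⟨(z, t), ⟨hz, ht.1, le_rfl⟩, sub_nonpos.2 hcon⟩ continuous_snd.continuousOn
  simp only [mem_preimage, mem_Iic] at hle₀
  have ht₀' : t₀ ∈ Ico 0 T := hsub ht₀
  have hpos : 0 < t₀ := by
    rcases ht₀.1.eq_or_lt with h1 | h1
    · have := h0 z₀ hz₀
      rw [h1] at this
      linarith
    · exact h1
  have hbefore : ∀ y ∈ Sph n, ∀ s, 0 < s → s < t₀ → Φ.φ y s < u y s := by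
    intro y hy s hs hst
    by_contra! hc
    have := hmin (show (y, s) ∈ S from ⟨⟨hy, hs.le, hst.le.trans ht₀.2⟩, sub_nonpos.2 hc⟩)
    exact absurd (show t₀ ≤ s from this) (not_le.2 hst)
  have hat : ∀ y ∈ Sph n, Φ.φ y t₀ ≤ u y t₀ := by
    intro y hy
    have hu : Tendsto (u y) (𝓝[<] t₀) (𝓝 (u y t₀)) :=
      ((h.continuousOn_time hy).continuousAt (Ico_mem_nhds hpos ht₀'.2)).mono_left
        nhdsWithin_le_nhds
    have hφ : Tendsto (Φ.φ y) (𝓝[<] t₀) (𝓝 (Φ.φ y t₀)) :=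
      (Φ.hφt y hy t₀ hpos.le).continuousAt.mono_left nhdsWithin_le_nhds
    refine le_of_tendsto_of_tendsto hφ hu ?_
    filter_upwards [Ioo_mem_nhdsLT hpos] with s hs
    exact (hbefore y hy s hs.1 hs.2).le
  have heq : u z₀ t₀ = Φ.φ z₀ t₀ := le_antisymm (by linarith) (hat z₀ hz₀)
  have hcφ := Φ.contDiffAt hz₀ hpos.le
  have hcu := h.contDiffAt hz₀ ht₀'
  have hcnu : ContDiffAt ℝ 2 (fun x => (-1) * u x t₀) z₀ := contDiffAt_const.mul hcu
  have hcnφ : ContDiffAt ℝ 2 (fun x => (-1) * Φ.φ x t₀) z₀ := contDiffAt_const.mul hcφ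
  have hmax : IsLocalMax (fun x => Φ.φ x t₀ + (-1) * u x t₀) z₀ := by
    filter_upwards [isOpen_compl_singleton.mem_nhds (ne_zero_of_mem_sph hz₀)] with x hx
    have hx0 : x ≠ 0 := hx
    have hn := norm_pos_iff.2 hx0
    have h1 := hat _ (normalize_mem_sph hx0)
    have h2 := h.homog t₀ ht₀' ‖x‖ hn (‖x‖⁻¹ • x)
    have h3 := Φ.homog t₀ hpos.le ‖x‖ hn (‖x‖⁻¹ • x)
    rw [norm_smul_normalize hx0] at h2 h3
    rw [h2, h3, heq]
    nlinarith
  have hH : ∀ v, 0 ≤ hbil (fun x => u x t₀ + (-1) * Φ.φ x t₀) z₀ v v := by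
    intro v
    have := hbil_nonpos_of_isLocalMax (hcφ.add hcnu) hmax v
    rw [hbil_add hcφ hcnu, hbil_const_mul] at this
    rw [hbil_add hcu hcnφ, hbil_const_mul]
    linarith
  have hP := posSemidef_hessMatrix (hcu.add hcnφ) hH
  obtain ⟨hApos, hAdet⟩ := Φ.radii hz₀ hpos.le
  have hdet := hApos.det_le_det_add hP
  have hsum : hessMatrix n (fun x => Φ.φ x t₀) z₀ + radialMatrix n z₀ +
      hessMatrix n (fun x => u x t₀ + (-1) * Φ.φ x t₀) z₀ =
      hessMatrix n (fun x => u x t₀) z₀ + radialMatrix n z₀ := by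
    ext i j
    simp only [Matrix.add_apply, hessMatrix, of_apply, hbil_add hcu hcnφ, hbil_const_mul]
    ring
  rw [hsum, hAdet, ← suppHessDet_eq_det] at hdet
  have hprod : 0 < ∏ i, (Φ.μ i z₀ t₀)⁻¹ :=
    Finset.prod_pos fun i _ => inv_pos.2 (Φ.μ_pos i z₀ hz₀ t₀ hpos.le)
  have hF : (suppHessDet n (fun x => u x t₀) z₀) ^ (-α) ≤ C₀ := by
    refine (Real.rpow_le_rpow_of_nonpos hprod hdet (by linarith)).trans ?_
    refine le_trans (le_of_eq ?_) (hC.le hα hz₀ hpos.le)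
    have hμ : 0 ≤ ∏ i, Φ.μ i z₀ t₀ :=
      Finset.prod_nonneg fun i _ => (Φ.μ_pos i z₀ hz₀ t₀ hpos.le).le
    rw [Finset.prod_inv_distrib, Real.inv_rpow hμ, Real.rpow_neg hμ, inv_inv]
  have hder := h.eqn z₀ hz₀ t₀ ⟨hpos, ht₀'.2⟩
  rw [heq, sub_self, P.at_zero] at hder
  have hnn := deriv_nonneg_of_le_left ((Φ.hφt z₀ hz₀ t₀ hpos.le).sub hder) hpos fun s hs hst => by
    simp only [Pi.sub_apply]
    linarith [hbefore z₀ hz₀ s hs hst]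
  linarith [Φ.φt_neg z₀ hz₀ t₀ hpos.le]

/-- The solution never exceeds its initial value. -/
lemma le_initial (h : IsPenalizedSol n α T δ C₀ Φ P u) (h0 : ∀ z ∈ Sph n, δ < u z 0 - Φ.φ z 0)
    {z : ES n} (hz : z ∈ Sph n) {t : ℝ}
    (ht : t ∈ Ico 0 T) : u z t ≤ u z 0 := by
  by_contra! hcon
  have hsub : Icc 0 t ⊆ Ico 0 T := fun s hs => ⟨hs.1, hs.2.trans_lt ht.2⟩
  obtain ⟨t₀, ht₀, hmax⟩ := isCompact_Icc.exists_isMaxOn (nonempty_Icc.2 ht.1)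
    ((h.continuousOn_time hz).mono hsub)
  have h1 : u z 0 < u z t₀ := hcon.trans_le (hmax (right_mem_Icc.2 ht.1))
  have hpos : 0 < t₀ := by
    rcases ht₀.1.eq_or_lt with h2 | h2
    · rw [← h2] at h1
      exact absurd h1 (lt_irrefl _)
    · exact h2
  have hder := h.eqn z hz t₀ ⟨hpos, (hsub ht₀).2⟩
  have hφ : Φ.φ z t₀ ≤ Φ.φ z 0 := Φ.antitone hz self_mem_Ici hpos.le hpos.le
  rw [P.zero_of_ge _ (by linarith [h0 z hz])] at hder
  have hnn := deriv_nonneg_of_le_left hder hpos fun s hs hst =>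
    hmax ⟨hs.le, hst.le.trans ht₀.2⟩
  have := Real.rpow_pos_of_pos (h.suppHessDet_pos hz (hsub ht₀)) (-α)
  linarith

/-- Curvature bound at a positive space-time maximum of the quotient of the speed
`-∂ₜu = K^α + β(u - φ)` by `u - ε`. -/
lemma inv_suppHessDet_le_of_max (h : IsPenalizedSol n α T δ C₀ Φ P u) (hα : 0 < α) {ε lam : ℝ}
    (hε : 0 < ε) (hε1 : ε ≤ 1)
    (hlam : 0 < lam) {z₀ : ES n} (hz₀ : z₀ ∈ Sph n) {t₀ : ℝ} (ht₀ : t₀ ∈ Ioo 0 T)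
    (hle : ∀ z ∈ Sph n, ∀ t, 0 < t → t ≤ t₀ →
      (suppHessDet n (fun x => u x t) z) ^ (-α) + P.β (u z t - Φ.φ z t) ≤ lam * (u z t - ε))
    (heq : (suppHessDet n (fun x => u x t₀) z₀) ^ (-α) + P.β (u z₀ t₀ - Φ.φ z₀ t₀) =
      lam * (u z₀ t₀ - ε))
    (hpen : -Φ.φt z₀ t₀ ≤
      (suppHessDet n (fun x => u x t₀) z₀) ^ (-α) + P.β (u z₀ t₀ - Φ.φ z₀ t₀)) :
    (suppHessDet n (fun x => u x t₀) z₀)⁻¹ ≤ ((n + 1 + 1 / α) / ε) ^ (n + 1) := by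
  have ht₀' : t₀ ∈ Ico 0 T := ⟨ht₀.1.le, ht₀.2⟩
  set f : ES n × ℝ → ℝ := fun p => u p.1 p.2 with hf
  have hU : IsOpen ({(0 : ES n)}ᶜ : Set (ES n)) := isOpen_compl_singleton
  have hsm : ContDiffOn ℝ ∞ f ({(0 : ES n)}ᶜ ×ˢ Ioo 0 T) :=
    h.smooth.mono (prod_mono subset_rfl Ioo_subset_Ico_self)
  have hO : IsOpen (({(0 : ES n)}ᶜ : Set (ES n)) ×ˢ Ioo 0 T) := hU.prod isOpen_Ioo
  have hdt : ∀ x : ES n, x ≠ 0 → HasDerivAt (u x) (timeDeriv f (x, t₀)) t₀ := fun x hx =>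
    hasDerivAt_timeDeriv (f := f) ((hsm.contDiffAt (hO.mem_nhds
      (show (x, t₀) ∈ ({(0 : ES n)}ᶜ : Set (ES n)) ×ˢ Ioo 0 T from ⟨hx, ht₀⟩))).differentiableAt
      (by simp))
  have hdt_sph : ∀ z ∈ Sph n, timeDeriv f (z, t₀) =
      -((suppHessDet n (fun x => u x t₀) z) ^ (-α)) - P.β (u z t₀ - Φ.φ z t₀) := fun z hz =>
    (hdt z (ne_zero_of_mem_sph hz)).unique (h.eqn z hz t₀ ht₀)
  have hdt_hom : ∀ x : ES n, x ≠ 0 → ∀ c : ℝ, 0 < c →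
      timeDeriv f (c • x, t₀) = c * timeDeriv f (x, t₀) := by
    intro x hx c hc
    refine (hdt (c • x) (smul_ne_zero hc.ne' hx)).unique
      (((hdt x hx).const_mul c).congr_of_eventuallyEq ?_)
    filter_upwards [isOpen_Ioo.mem_nhds ht₀] with s hs
    exact h.homog s ⟨hs.1.le, hs.2⟩ c hc x
  have hg : ContDiffAt ℝ 2 (fun x => timeDeriv f (x, t₀)) z₀ :=
    (contDiffAt_slice hU (contDiffOn_timeDeriv hO hsm) (ne_zero_of_mem_sph hz₀) ht₀).of_le
      (WithTop.coe_le_coe.2 (le_top : (2 : ℕ∞) ≤ ⊤))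
  have hnz₀ := norm_of_mem_sph hz₀
  have hmax : IsLocalMax (fun x => (-1) * timeDeriv f (x, t₀) +
      ((-lam) * u x t₀ + (lam * ε) * ‖x‖)) z₀ := by
    filter_upwards [hU.mem_nhds (ne_zero_of_mem_sph hz₀)] with x hx
    have hx0 : x ≠ 0 := hx
    have hn := norm_pos_iff.2 hx0
    have hy := normalize_mem_sph hx0
    have h1 := hle _ hy t₀ ht₀.1 le_rfl
    have h2 := h.homog t₀ ht₀' ‖x‖ hn (‖x‖⁻¹ • x)
    have h3 := hdt_hom _ (ne_zero_of_mem_sph hy) ‖x‖ hn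
    have h4 := hdt_sph _ hy
    have h5 := hdt_sph _ hz₀
    rw [norm_smul_normalize hx0] at h2 h3
    rw [h2, h3, hnz₀, h4, h5]
    nlinarith
  have hA := h.posDef hz₀ ht₀'
  have htr := trace_inv_mul_hessMatrix_ge hnz₀ (h.contDiffAt hz₀ ht₀') hg hA hlam.le hε1 hmax
  have hDder : HasDerivAt (fun s => suppHessDet n (fun x => u x s) z₀)
      (suppHessDet n (fun x => u x t₀) z₀ *
        ((hessMatrix n (fun x => u x t₀) z₀ + radialMatrix n z₀)⁻¹ *
          hessMatrix n (fun x => timeDeriv f (x, t₀)) z₀).trace) t₀ :=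
    HasDerivAt.matrix_det (A := fun s => hessMatrix n (fun x => u x s) z₀ + radialMatrix n z₀)
      (fun i j => (hasDerivAt_hbil_slice (f := f) hU isOpen_Ioo hsm (ne_zero_of_mem_sph hz₀) ht₀
        _ _).add_const _) hA.det_pos.ne'
  set A := hessMatrix n (fun x => u x t₀) z₀ + radialMatrix n z₀ with hAdef
  set τ := (A⁻¹ * hessMatrix n (fun x => timeDeriv f (x, t₀)) z₀).trace with hτ
  set D := suppHessDet n (fun x => u x t₀) z₀ with hD
  have hDpos : 0 < D := h.suppHessDet_pos hz₀ ht₀'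
  have hFpos : 0 < D ^ (-α) := Real.rpow_pos_of_pos hDpos _
  have hFder : HasDerivAt (fun s => (suppHessDet n (fun x => u x s) z₀) ^ (-α))
      (-α * D ^ (-α) * τ) t₀ := by
    refine (hDder.rpow_const (p := -α) (Or.inl hDpos.ne')).congr_deriv ?_
    rw [← hD, Real.rpow_sub_one hDpos.ne']
    field_simp
  have huder := h.eqn z₀ hz₀ t₀ ht₀
  have hφder := Φ.hφt z₀ hz₀ t₀ ht₀.1.le
  have hβder := ((P.smooth.differentiable (by simp)) (u z₀ t₀ - Φ.φ z₀ t₀)).hasDerivAt.comp t₀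
    (huder.sub hφder)
  have hβ' : 0 ≤ deriv P.β (u z₀ t₀ - Φ.φ z₀ t₀) := P.mono.deriv_nonneg
  have hβ := P.nonpos (u z₀ t₀ - Φ.φ z₀ t₀)
  have htime := deriv_nonneg_of_le_left
    ((hFder.add hβder).sub ((huder.sub_const ε).const_mul lam)) ht₀.1 fun s hs hst => by
      have := hle z₀ hz₀ s hs hst.le
      simp only [Pi.sub_apply, Pi.add_apply, Function.comp_apply]
      linarith
  set b := P.β (u z₀ t₀ - Φ.φ z₀ t₀)
  have hneg : deriv P.β (u z₀ t₀ - Φ.φ z₀ t₀) * (-(D ^ (-α)) - b - Φ.φt z₀ t₀) ≤ 0 :=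
    mul_nonpos_of_nonneg_of_nonpos hβ' (by linarith)
  have hkey : 0 ≤ (lam * D ^ (-α)) * (1 - α * (ε * A⁻¹.trace - (n + 1))) := by
    nlinarith [mul_le_mul_of_nonneg_left htr (mul_pos hα hFpos).le,
      mul_nonneg hlam.le (neg_nonneg.2 hβ)]
  have h1 : 0 ≤ 1 - α * (ε * A⁻¹.trace - (n + 1)) :=
    nonneg_of_mul_nonneg_right hkey (mul_pos hlam hFpos)
  have htrle : A⁻¹.trace ≤ (n + 1 + 1 / α) / ε := by
    rw [le_div_iff₀ hε]
    have : α * (1 / α) = 1 := by field_simp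
    nlinarith
  have hdet : D⁻¹ = A⁻¹.det := by
    rw [det_nonsing_inv, Ring.inverse_eq_inv', hD, suppHessDet_eq_det]
  rw [hdet]
  refine hA.inv.posSemidef.det_le_trace_pow.trans ?_
  rw [Fintype.card_fin]
  exact pow_le_pow_left₀ hA.inv.posSemidef.trace_nonneg htrle _

lemma continuousOn_suppHessDet (h : IsPenalizedSol n α T δ C₀ Φ P u) :
    ContinuousOn (fun p : ES n × ℝ => suppHessDet n (fun x => u x p.2) p.1)
      (Sph n ×ˢ Ico 0 T) := by
  have hc : ∀ v w, ContinuousOn (fun p : ES n × ℝ => hbil (fun x => u x p.2) p.1 v w)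
      (Sph n ×ˢ Ico 0 T) := fun v w =>
    (continuousOn_hbil_slice (f := fun p : ES n × ℝ => u p.1 p.2) isOpen_compl_singleton
      (uniqueDiffOn_Ico 0 T) h.smooth v w).mono
      (prod_mono (fun _ => ne_zero_of_mem_sph) subset_rfl)
  simp only [suppHessDet, det_apply, of_apply]
  refine continuousOn_finsetSum _ fun σ _ => ContinuousOn.const_smul ?_ _
  refine continuousOn_finsetProd _ fun i _ => (hc _ _).add ?_
  fun_prop

end IsPenalizedSol

lemma suppHessDet_congr {f g : ES n → ℝ} {z : ES n} (hfg : f =ᶠ[𝓝 z] g) :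
    suppHessDet n f z = suppHessDet n g z := by
  simp only [suppHessDet, hbil_congr hfg]

lemma suppHessDet_eq_of_eqOn_sph {f g : ES n → ℝ}
    (hf : ∀ c : ℝ, 0 < c → ∀ x, f (c • x) = c * f x)
    (hg : ∀ c : ℝ, 0 < c → ∀ x, g (c • x) = c * g x) (hfg : ∀ z ∈ Sph n, f z = g z) {z : ES n}
    (hz : z ∈ Sph n) : suppHessDet n f z = suppHessDet n g z := by
  refine suppHessDet_congr ?_
  filter_upwards [isOpen_compl_singleton.mem_nhds (ne_zero_of_mem_sph hz)] with x hx
  have hx0 : x ≠ 0 := hx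
  rw [← norm_smul_normalize hx0, hf _ (norm_pos_iff.2 hx0), hg _ (norm_pos_iff.2 hx0),
    hfg _ (normalize_mem_sph hx0)]

namespace IsSupportOfSmoothBody

variable {u₀ : ES n → ℝ}

lemma suppHessDet_pos (h : IsSupportOfSmoothBody n u₀) {z : ES n} (hz : z ∈ Sph n) :
    0 < suppHessDet n u₀ z :=
  (posDef_radii (norm_of_mem_sph hz) h.1
    ((h.2.1.contDiffAt (isOpen_compl_singleton.mem_nhds (ne_zero_of_mem_sph hz))).of_le
      (WithTop.coe_le_coe.2 (le_top : (2 : ℕ∞) ≤ ⊤))) (h.2.2 z hz)).det_pos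

lemma continuousOn_suppHessDet (h : IsSupportOfSmoothBody n u₀) : ContinuousOn (suppHessDet n u₀)
    (Sph n) := by
  have hsm : ContDiffOn ℝ ∞ (fun p : ES n × ℝ => u₀ p.1) ({(0 : ES n)}ᶜ ×ˢ Icc 0 1) :=
    h.2.1.comp contDiff_fst.contDiffOn fun p hp => hp.1
  have hc : ∀ v w, ContinuousOn (fun z => hbil u₀ z v w) (Sph n) := fun v w =>
    (continuousOn_hbil_slice isOpen_compl_singleton
      (uniqueDiffOn_Icc zero_lt_one) hsm v w).comp (f := fun z : ES n => (z, (0 : ℝ)))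
      (by fun_prop) fun z hz => ⟨ne_zero_of_mem_sph hz, by simp⟩
  change ContinuousOn (fun z => suppHessDet n u₀ z) (Sph n)
  simp only [suppHessDet, det_apply, of_apply]
  refine continuousOn_finsetSum _ fun σ _ => ContinuousOn.const_smul ?_ _
  refine continuousOn_finsetProd _ fun i _ => (hc _ _).add ?_
  fun_prop

lemma exists_speed_le (h : IsSupportOfSmoothBody n u₀) (α : ℝ) :
    ∃ B, ∀ z ∈ Sph n, ((suppHessDet n u₀ z)⁻¹) ^ α ≤ B := by
  have hc : ContinuousOn (fun z => ((suppHessDet n u₀ z)⁻¹) ^ α) (Sph n) :=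
    (h.continuousOn_suppHessDet.inv₀ fun z hz => (h.suppHessDet_pos hz).ne').rpow_const
      fun z hz => Or.inl (inv_pos.2 (h.suppHessDet_pos hz)).ne'
  obtain ⟨B, hB⟩ := isCompact_sph.bddAbove_image hc
  exact ⟨B, fun z hz => hB (mem_image_of_mem _ hz)⟩

lemma exists_le (h : IsSupportOfSmoothBody n u₀) : ∃ B, ∀ z ∈ Sph n, u₀ z ≤ B := by
  obtain ⟨B, hB⟩ := isCompact_sph.bddAbove_image
    (h.2.1.continuousOn.mono fun z => ne_zero_of_mem_sph)
  exact ⟨B, fun z hz => hB (mem_image_of_mem _ hz)⟩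

end IsSupportOfSmoothBody

/-- The a priori curvature bound, in terms of an inner radius `ρ` of the obstacle, an upper bound
`R` of the initial support function and an upper bound `V` of the initial speed and of the speed
allowed at an interior maximum. -/
lemma IsPenalizedSol.inv_suppHessDet_le (h : IsPenalizedSol n α T δ C₀ Φ P u) (hα : 0 < α)
    (hδ : 0 < δ) (hC : PenaltyConst n α Φ C₀) (h0 : ∀ z ∈ Sph n, δ < u z 0 - Φ.φ z 0)
    {ρ ε R V : ℝ} (hε : 0 < ε) (hε1 : ε ≤ 1) (hερ : ε ≤ ρ / 2)
    (hρ : ∀ z ∈ Sph n, ∀ t, 0 ≤ t → ρ ≤ Φ.φ z t)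
    (hR : ∀ z ∈ Sph n, u z 0 ≤ R)
    (hV0 : ∀ z ∈ Sph n, (suppHessDet n (fun x => u x 0) z) ^ (-α) ≤ V)
    (hVφ : ∀ z ∈ Sph n, -Φ.φt z 0 ≤ V)
    (hV : (((n + 1 + 1 / α) / ε) ^ (n + 1)) ^ α ≤ V)
    {z : ES n} (hz : z ∈ Sph n) {t : ℝ} (ht : t ∈ Ico 0 T) :
    (suppHessDet n (fun x => u x t) z)⁻¹ ≤ (V / ε * R + C₀) ^ (1 / α) := by
  have hsub : Icc 0 t ⊆ Ico 0 T := fun s hs => ⟨hs.1, hs.2.trans_lt ht.2⟩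
  have hlt : ∀ y ∈ Sph n, ∀ s ∈ Ico 0 T, Φ.φ y s < u y s := fun y hy s hs =>
    h.obstacle_lt hα hC (fun z hz => by linarith [h0 z hz]) hy hs
  have hgap : ∀ y ∈ Sph n, ∀ s ∈ Ico 0 T, ε < u y s - ε := fun y hy s hs => by
    linarith [hlt y hy s hs, hρ y hy s hs.1]
  have hV0' : 0 ≤ V := le_trans (by positivity) hV
  set F : ES n × ℝ → ℝ := fun p =>
    (suppHessDet n (fun x => u x p.2) p.1) ^ (-α) + P.β (u p.1 p.2 - Φ.φ p.1 p.2) with hF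
  have hK : Sph n ×ˢ Icc 0 t ⊆ Sph n ×ˢ Ico 0 T := prod_mono subset_rfl hsub
  have hcu := h.continuousOn.mono hK
  have hcφ : ContinuousOn (fun p : ES n × ℝ => Φ.φ p.1 p.2) (Sph n ×ˢ Icc 0 t) :=
    Φ.smooth.continuousOn.mono (prod_mono (fun _ => ne_zero_of_mem_sph) fun s hs => hs.1)
  have hcF : ContinuousOn F (Sph n ×ˢ Icc 0 t) :=
    ((h.continuousOn_suppHessDet.mono hK).rpow_const
      fun p hp => Or.inl (h.suppHessDet_pos hp.1 (hsub hp.2)).ne').add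
      (P.smooth.continuous.comp_continuousOn (hcu.sub hcφ))
  have hcQ : ContinuousOn (fun p : ES n × ℝ => F p / (u p.1 p.2 - ε)) (Sph n ×ˢ Icc 0 t) :=
    hcF.div (hcu.sub continuousOn_const) fun p hp =>
      (hε.trans (hgap _ hp.1 _ (hsub hp.2))).ne'
  obtain ⟨⟨z₀, t₀⟩, ⟨hz₀, ht₀⟩, hmax⟩ := (isCompact_sph.prod isCompact_Icc).exists_isMaxOn
    ⟨(z, t), hz, ht.1, le_rfl⟩ hcQ
  set lam := F (z₀, t₀) / (u z₀ t₀ - ε) with hlam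
  have hgap₀ := hgap z₀ hz₀ t₀ (hsub ht₀)
  have hle : ∀ y ∈ Sph n, ∀ s ∈ Icc 0 t, F (y, s) ≤ lam * (u y s - ε) := fun y hy s hs =>
    (div_le_iff₀ (hε.trans (hgap y hy s (hsub hs)))).1 (hmax (show (y, s) ∈ _ from ⟨hy, hs⟩))
  have heq : F (z₀, t₀) = lam * (u z₀ t₀ - ε) := (div_mul_cancel₀ _ (hε.trans hgap₀).ne').symm
  have hD₀ := h.suppHessDet_pos hz₀ (hsub ht₀)
  have hFle : F (z₀, t₀) ≤ V := by
    rcases ht₀.1.eq_or_lt with h1 | hpos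
    · simp only [hF]
      rw [show t₀ = 0 from h1.symm]
      linarith [hV0 z₀ hz₀, P.nonpos (u z₀ 0 - Φ.φ z₀ 0)]
    rcases le_or_gt lam 0 with hl | hl
    · rw [heq]
      exact (mul_nonpos_of_nonpos_of_nonneg hl (hε.trans hgap₀).le).trans hV0'
    rcases le_or_gt (-Φ.φt z₀ t₀) (F (z₀, t₀)) with hp | hp
    · have hK := h.inv_suppHessDet_le_of_max hα hε hε1 hl hz₀ ⟨hpos, (hsub ht₀).2⟩
        (fun y hy s hs hst => hle y hy s ⟨hs.le, hst.trans ht₀.2⟩) heq hp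
      have h2 := Real.rpow_le_rpow (inv_pos.2 hD₀).le hK hα.le
      rw [Real.inv_rpow hD₀.le, ← Real.rpow_neg hD₀.le] at h2
      linarith [P.nonpos (u z₀ t₀ - Φ.φ z₀ t₀)]
    · linarith [hVφ z₀ hz₀, Φ.speed_nonincreasing z₀ hz₀ 0 t₀ le_rfl hpos.le]
  have hlamle : lam ≤ V / ε := by
    rw [hlam]
    exact div_le_div₀ hV0' hFle hε hgap₀.le
  have hu := hgap z hz t ht
  have huR : u z t - ε ≤ R := by
    linarith [h.le_initial h0 hz ht, hR z hz]
  have hFz : F (z, t) ≤ V / ε * R :=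
    (hle z hz t ⟨ht.1, le_rfl⟩).trans ((mul_le_mul_of_nonneg_right hlamle (hε.trans hu).le).trans
      (mul_le_mul_of_nonneg_left huR (by positivity)))
  have hβ := P.neg_le (sub_nonneg.2 (hlt z hz t ht).le)
  have hD := h.suppHessDet_pos hz ht
  have hfin : (suppHessDet n (fun x => u x t) z) ^ (-α) ≤ V / ε * R + C₀ := by
    simp only [hF] at hFz
    linarith
  rw [Real.rpow_neg hD.le, ← Real.inv_rpow hD.le] at hfin
  have hinv := (inv_pos.2 hD).le
  calc (suppHessDet n (fun x => u x t) z)⁻¹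
      = (((suppHessDet n (fun x => u x t) z)⁻¹) ^ α) ^ (1 / α) := by
        rw [← Real.rpow_mul hinv, mul_one_div_cancel hα.ne', Real.rpow_one]
    _ ≤ _ := Real.rpow_le_rpow (Real.rpow_nonneg hinv _) hfin (by positivity)

end Penalized

theorem statement_9 (n : ℕ) (hn : 0 < n) (α : ℝ) (hα : 0 < α)
    (Φ : ShrinkingObstacle n)
    (u₀ : ES n → ℝ) (hbody : IsSupportOfSmoothBody n u₀)
    (hencl : Encloses n α u₀ Φ) :
    ∃ C : ℝ, ∀ T δ C₀ : ℝ, 0 < T → 0 < δ →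
      (∀ z ∈ Sph n, δ < u₀ z - Φ.φ z 0) → PenaltyConst n α Φ C₀ →
      ∀ P : Penalty δ C₀, ∀ u : ES n → ℝ → ℝ,
        IsPenalizedSol n α T δ C₀ Φ P u → (∀ z ∈ Sph n, u z 0 = u₀ z) →
        ∀ z ∈ Sph n, ∀ t ∈ Set.Ico (0 : ℝ) T,
          (suppHessDet n (fun x => u x t) z)⁻¹ ≤ C := by
  obtain ⟨ρ, hρ, hφρ⟩ := Φ.interior_point
  obtain ⟨B, hB⟩ := hbody.exists_speed_le α
  obtain ⟨R, hR⟩ := hbody.exists_le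
  set ε := min (ρ / 2) 1 with hε
  set V := max B (((((n : ℝ) + 1 + 1 / α) / ε) ^ (n + 1)) ^ α) with hV
  refine ⟨(V / ε * R + sSup {y : ℝ | ∃ z ∈ Sph n, ∃ t : ℝ, 0 ≤ t ∧
    y = (∏ i, Φ.μ i z t) ^ α}) ^ (1 / α), ?_⟩
  intro T δ C₀ hT hδ hgap hC P u h hu₀ z hz t ht
  have hD : ∀ y ∈ Sph n, suppHessDet n (fun x => u x 0) y = suppHessDet n u₀ y := fun y hy =>
    suppHessDet_eq_of_eqOn_sph (h.homog 0 ⟨le_rfl, hT⟩) hbody.1 hu₀ hy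
  have hmain := h.inv_suppHessDet_le (ρ := ρ) (ε := ε) (R := R) (V := V) hα hδ hC
    (fun y hy => by rw [hu₀ y hy]; exact hgap y hy) (lt_min (by positivity) one_pos)
    (min_le_right _ _) (min_le_left _ _) hφρ (fun y hy => by rw [hu₀ y hy]; exact hR y hy)
    (fun y hy => ?_) (fun y hy => ?_) (le_max_right _ _) hz ht
  · exact hmain.trans_eq (by rw [← show C₀ = _ from hC])
  · rw [hD y hy, Real.rpow_neg (hbody.suppHessDet_pos hy).le,
      ← Real.inv_rpow (hbody.suppHessDet_pos hy).le]
    exact (hB y hy).trans (le_max_left _ _)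
  · exact (hencl.2.1 y hy y hy).le.trans ((hB y hy).trans (le_max_left _ _))
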